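/- Let ℍ := Quaternion ℝ, let M := ℂ ⊗[ℝ] ℍ, and let q ∈ ℍ with q.im ≠ 0. With κ := ‖q.im‖⁻¹ • q.im, ι₊ := (2:ℂ)⁻¹ • ((1 : M) − Complex.I • ((1:ℂ) ⊗ₜ κ)), ι₋ := (2:ℂ)⁻¹ • ((1 : M) + Complex.I • ((1:ℂ) ⊗ₜ κ)), and λ := (q.re : ℂ) + ‖q.im‖ * Complex.I, for every natural number n one has (1:ℂ) ⊗ₜ (q^n) = (λ^n) • ι₊ + ((conj λ)^n) • ι₋. -/

import Mathlib

open TensorProduct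

/-- Powers of `a + b k`, where `k` is a square root of `-1`, in terms of the complementary
idempotents `(1 ∓ i k) / 2` defined by a scalar square root `i` of `-1`. -/
theorem smul_one_add_smul_pow_of_mul_self_eq_neg_one {K A : Type*} [Field K] [NeZero (2 : K)]
    [Ring A] [Algebra K A] {i : K} (hi : i * i = -1) {k : A} (hk : k * k = -1) (a b : K) (n : ℕ) :
    (a • (1 : A) + b • k) ^ n =
      (a + b * i) ^ n • ((2 : K)⁻¹ • (1 - i • k)) +
        (a - b * i) ^ n • ((2 : K)⁻¹ • (1 + i • k)) := by
  induction n with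
  | zero =>
    simp only [pow_zero, one_smul, ← smul_add, sub_add_add_cancel, ← two_smul K (1 : A)]
    rw [inv_smul_smul₀ (NeZero.ne 2)]
  | succ n ih =>
    have hp : (1 - i • k) * (a • (1 : A) + b • k) = (a + b * i) • (1 - i • k) := by
      simp only [mul_add, sub_mul, mul_smul_comm, smul_mul_assoc, hk, one_mul, mul_one]
      match_scalars
      · ring
      · linear_combination b * hi
    have hm : (1 + i • k) * (a • (1 : A) + b • k) = (a - b * i) • (1 + i • k) := by
      simp only [mul_add, add_mul, mul_smul_comm, smul_mul_assoc, hk, one_mul, mul_one]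
      match_scalars
      · ring
      · linear_combination b * hi
    rw [pow_succ, ih, add_mul]
    simp only [smul_mul_assoc, hp, hm]
    module

theorem TensorProduct.one_tmul_smul_add_smul {V : Type*} [AddCommGroup V] [Module ℝ V]
    (a b : ℝ) (x y : V) :
    (1 : ℂ) ⊗ₜ[ℝ] (a • x + b • y) =
      (a : ℂ) • ((1 : ℂ) ⊗ₜ[ℝ] x) + (b : ℂ) • ((1 : ℂ) ⊗ₜ[ℝ] y) := by
  rw [TensorProduct.smul_tmul', TensorProduct.smul_tmul', Complex.coe_smul, Complex.coe_smul,
    TensorProduct.smul_tmul, TensorProduct.smul_tmul, TensorProduct.tmul_add]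

theorem Quaternion.normalized_im_mul_self {q : Quaternion ℝ} (hq : q.im ≠ 0) :
    (‖q.im‖⁻¹ • q.im) * (‖q.im‖⁻¹ • q.im) = -1 := by
  have hr : ‖q.im‖ ≠ 0 := norm_ne_zero_iff.mpr hq
  have h : q.im * q.im = -((‖q.im‖ * ‖q.im‖ : ℝ) : Quaternion ℝ) := by
    rw [← Quaternion.normSq_eq_norm_mul_self, ← Quaternion.self_mul_star, Quaternion.star_im,
      mul_neg, neg_neg]
  rw [smul_mul_smul_comm, h, smul_neg, Quaternion.smul_coe, ← mul_inv,
    inv_mul_cancel₀ (mul_ne_zero hr hr), Quaternion.coe_one]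

theorem quaternion_pow_decomposition (q : Quaternion ℝ) (hq : q.im ≠ 0) (n : ℕ) :
    let κ : Quaternion ℝ := ‖q.im‖⁻¹ • q.im
    let ιp : ℂ ⊗[ℝ] Quaternion ℝ :=
      (2 : ℂ)⁻¹ • ((1 : ℂ ⊗[ℝ] Quaternion ℝ) - Complex.I • ((1 : ℂ) ⊗ₜ[ℝ] κ))
    let ιm : ℂ ⊗[ℝ] Quaternion ℝ :=
      (2 : ℂ)⁻¹ • ((1 : ℂ ⊗[ℝ] Quaternion ℝ) + Complex.I • ((1 : ℂ) ⊗ₜ[ℝ] κ))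
    let lam : ℂ := (q.re : ℂ) + ‖q.im‖ * Complex.I
    (1 : ℂ) ⊗ₜ[ℝ] (q ^ n) = (lam ^ n) • ιp + (((starRingEnd ℂ) lam) ^ n) • ιm := by
  intro κ ιp ιm lam
  have hκ : κ * κ = -1 := Quaternion.normalized_im_mul_self hq
  have hqκ : q = q.re • (1 : Quaternion ℝ) + ‖q.im‖ • κ := by
    rw [smul_inv_smul₀ (norm_ne_zero_iff.mpr hq), ← Algebra.algebraMap_eq_smul_one]
    exact (Quaternion.re_add_im q).symm
  have hk : (1 : ℂ) ⊗ₜ[ℝ] κ * (1 : ℂ) ⊗ₜ[ℝ] κ = -1 := by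
    rw [Algebra.TensorProduct.tmul_mul_tmul, hκ, one_mul, TensorProduct.tmul_neg]
    rfl
  have hqk : (1 : ℂ) ⊗ₜ[ℝ] q = (q.re : ℂ) • (1 : ℂ ⊗[ℝ] Quaternion ℝ) +
      (‖q.im‖ : ℂ) • ((1 : ℂ) ⊗ₜ[ℝ] κ) := by
    refine (congrArg _ hqκ).trans ?_
    exact TensorProduct.one_tmul_smul_add_smul _ _ _ _
  have hlam : (starRingEnd ℂ) lam = q.re - ‖q.im‖ * Complex.I := by
    simp [lam, sub_eq_add_neg]
  have hpow : (1 : ℂ) ⊗ₜ[ℝ] (q ^ n) = ((1 : ℂ) ⊗ₜ[ℝ] q) ^ n := by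
    rw [Algebra.TensorProduct.tmul_pow, one_pow]
  rw [hpow, hqk, hlam]
  exact smul_one_add_smul_pow_of_mul_self_eq_neg_one
    (A := ℂ ⊗[ℝ] Quaternion ℝ) Complex.I_mul_I hk _ _ n
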